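/- The language MPal# = {w₁ # w₂ # ⋯ # w_m ## v₁ # v₂ # ⋯ # v_n : m, n ≥ 1, w₁,...,w_m, v₁,...,v_n ∈ {0,1}*, and there exists i ∈ [min{m,n}] with vᵢ = wᵢ^R} over the alphabet {0,1,#} (where wᵢ^R denotes the reverse of wᵢ) belongs to neither DCFL(ω) nor DCFL[ω]; that is, for every integer d ≥ 1, MPal# ∉ DCFL(d) and MPal# ∉ DCFL[d]. -/

import Mathlib

/-!
Formalization of one-way deterministic pushdown automata (1dpda) following
Yamakami, "Intersection and Union Hierarchies of Deterministic Context-Free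
Languages and Pumping Lemmas".
-/

namespace DCFLFormal

/-- Tape symbols: the left endmarker ¢, the right endmarker $, and input symbols. -/
inductive TSym (α : Type) : Type
  | lend : TSym α
  | rend : TSym α
  | ch : α → TSym α

/-- A one-way deterministic pushdown automaton (1dpda).  `δ q (some t) a` is the
transition reading the tape symbol `t` with top stack symbol `a`; `δ q none a`
is the ε-transition.  The value `some (p, w)` means: change state to `p` and
replace the topmost stack symbol by the string `w`. -/
structure DPDA (Q α Γ : Type) where
  δ : Q → Option (TSym α) → Γ → Option (Q × List Γ)
  q0 : Q
  Z0 : Γ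
  Acc : Set Q
  Rej : Set Q

/-- A configuration: current state, remaining (unread) tape, and stack content
(topmost symbol first, the bottom marker last). -/
structure Cfg (Q α Γ : Type) where
  st : Q
  inp : List (TSym α)
  stk : List Γ

namespace DPDA

variable {Q α Γ : Type}

/-- Halting (accepting or rejecting) states. -/
def IsHalting (M : DPDA Q α Γ) (q : Q) : Prop := q ∈ M.Acc ∨ q ∈ M.Rej

/-- One step of the machine: an ε-move if one is defined, otherwise read the
next tape symbol; the head moves right exactly when a tape symbol is read. -/
def step (M : DPDA Q α Γ) (c : Cfg Q α Γ) : Option (Cfg Q α Γ) :=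
  match c.stk with
  | [] => none
  | a :: s =>
    match M.δ c.st none a with
    | some (p, w) => some ⟨p, c.inp, w ++ s⟩
    | none =>
      match c.inp with
      | [] => none
      | t :: rest =>
        match M.δ c.st (some t) a with
        | some (p, w) => some ⟨p, rest, w ++ s⟩
        | none => none

/-- Iterated steps. -/
def stepN (M : DPDA Q α Γ) : ℕ → Cfg Q α Γ → Option (Cfg Q α Γ)
  | 0, c => some c
  | n + 1, c => (M.step c).bind (M.stepN n)

/-- The tape holding ¢ x $. -/
def tape (x : List α) : List (TSym α) :=
  TSym.lend :: x.map TSym.ch ++ [TSym.rend]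

/-- The initial configuration on input `x`. -/
def init (M : DPDA Q α Γ) (x : List α) : Cfg Q α Γ := ⟨M.q0, tape x, [M.Z0]⟩

/-- `M` accepts `x`: the computation reaches an accepting state. -/
def Accepts (M : DPDA Q α Γ) (x : List α) : Prop :=
  ∃ n c, M.stepN n (M.init x) = some c ∧ c.st ∈ M.Acc

/-- `M` rejects `x`: the computation reaches a rejecting state. -/
def Rejects (M : DPDA Q α Γ) (x : List α) : Prop :=
  ∃ n c, M.stepN n (M.init x) = some c ∧ c.st ∈ M.Rej

/-- `M` halts (in an accepting or rejecting state) on every input. -/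
def HaltsOnAll (M : DPDA Q α Γ) : Prop :=
  ∀ x : List α, ∃ n c, M.stepN n (M.init x) = some c ∧ M.IsHalting c.st

/-- The language recognized by `M`. -/
def lang (M : DPDA Q α Γ) : Set (List α) := {x | M.Accepts x}

/-- Well-formedness of a 1dpda: accepting and rejecting states are disjoint,
halting states have no outgoing transitions, for every non-halting state,
stack symbol and (non-empty) tape symbol exactly one of the symbol- and the
ε-transition is defined, and the bottom marker Z₀ is never removed. -/
def Valid (M : DPDA Q α Γ) : Prop :=
  (∀ q, q ∈ M.Acc → q ∉ M.Rej) ∧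
  (∀ q, M.IsHalting q → ∀ σ a, M.δ q σ a = none) ∧
  (∀ q, ¬ M.IsHalting q → ∀ σ a, ((M.δ q (some σ) a).isSome ↔ M.δ q none a = none)) ∧
  (∀ q σ p w, M.δ q σ M.Z0 = some (p, w) → w ≠ [])

end DPDA

/-- A language is deterministic context-free if it is recognized by some 1dpda
(with finitely many states and stack symbols) that halts on all inputs. -/
def IsDCFL {α : Type} (L : Set (List α)) : Prop :=
  ∃ (Q Γ : Type) (_ : Fintype Q) (_ : Fintype Γ) (M : DPDA Q α Γ),
    M.Valid ∧ M.HaltsOnAll ∧ L = M.lang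

/-- `DCFL(d)`: intersections of `d` dcf languages. -/
def DCFLInter {α : Type} (d : ℕ) (L : Set (List α)) : Prop :=
  ∃ f : Fin d → Set (List α), (∀ i, IsDCFL (f i)) ∧ L = ⋂ i, f i

/-- `DCFL[d]`: unions of `d` dcf languages. -/
def DCFLUnion {α : Type} (d : ℕ) (L : Set (List α)) : Prop :=
  ∃ f : Fin d → Set (List α), (∀ i, IsDCFL (f i)) ∧ L = ⋃ i, f i

/-- `rep x i` is the string `x` repeated `i` times. -/
def rep {α : Type} (x : List α) (i : ℕ) : List α := (List.replicate i x).flatten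

/-- `(x, y)` is an iterative pair of the string `u ++ x ++ v ++ y ++ z` for `L`. -/
def IterPair {α : Type} (L : Set (List α)) (u x v y z : List α) : Prop :=
  1 ≤ (x ++ y).length ∧ ∀ i : ℕ, u ++ rep x i ++ v ++ rep y i ++ z ∈ L

/-- A nondegenerate iterative pair: either `{u xⁱ v yʲ z ∈ L : j ≥ 0}` is finite
for each `i`, or `{u xⁱ v yʲ z ∈ L : i ≥ 0}` is finite for each `j`. -/
def NonDegIterPair {α : Type} (L : Set (List α)) (u x v y z : List α) : Prop :=
  IterPair L u x v y z ∧
  ((∀ i : ℕ, {s | s ∈ L ∧ ∃ j : ℕ, s = u ++ rep x i ++ v ++ rep y j ++ z}.Finite) ∨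
   (∀ j : ℕ, {s | s ∈ L ∧ ∃ i : ℕ, s = u ++ rep x i ++ v ++ rep y j ++ z}.Finite))


/-- The language `MPal# = {w₁#⋯#w_m ## v₁#⋯#v_n : m,n ≥ 1, ∃ i < min m n, vᵢ = wᵢ^R}`
over the alphabet `Option Bool` (where `some b` is a bit and `none` is `#`). -/
def MPalSharp : Set (List (Option Bool)) :=
  {s | ∃ ws vs : List (List Bool), ws ≠ [] ∧ vs ≠ [] ∧
    s = (List.intersperse [(none : Option Bool)]
          (ws.map fun w => w.map (some : Bool → Option Bool))).flatten ++
        ([none, none] : List (Option Bool)) ++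
        (List.intersperse [(none : Option Bool)]
          (vs.map fun v => v.map (some : Bool → Option Bool))).flatten ∧
    ∃ (i : ℕ) (h₁ : i < ws.length) (h₂ : i < vs.length),
      vs.get ⟨i, h₂⟩ = (ws.get ⟨i, h₁⟩).reverse}

/-- Derivations of a pushdown system with states `X`, stack alphabet `Γ` and moves `Move`.
`Gen Move x s y v` says that a computation from `x` to `y` consumes exactly the stack word `s`,
the yields of its moves adding up to `v`. -/
inductive Gen {X Γ : Type} (Move : X → Γ → X → List Γ → (ℕ → ℕ) → Prop) :
    X → List Γ → X → (ℕ → ℕ) → Prop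
  | nil (x : X) : Gen Move x [] x 0
  | cons {x y z : X} {A : Γ} {s : List Γ} {u v : ℕ → ℕ} :
      Gen Move x [A] y u → Gen Move y s z v → Gen Move x (A :: s) z (u + v)
  | step {x x' y : X} {A : Γ} {w : List Γ} {e v : ℕ → ℕ} :
      Move x A x' w e → Gen Move x' w y v → Gen Move x [A] y (e + v)

/-- The weight of a yield: its two middle components. -/
def wt (v : ℕ → ℕ) : ℕ := v 1 + v 2

theorem wt_add (u v : ℕ → ℕ) : wt (u + v) = wt u + wt v := by
  simp only [wt, Pi.add_apply]; omega

/-- Moves push at most `R` symbols, have weight at most one, and their yields respect the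
phases `ph` of the states. -/
def Phased {X Γ : Type} (Move : X → Γ → X → List Γ → (ℕ → ℕ) → Prop) (ph : X → ℕ) (R : ℕ) :
    Prop :=
  ∀ x A x' w e, Move x A x' w e →
    ph x ≤ ph x' ∧ (∀ k, e k ≠ 0 → ph x ≤ k ∧ k ≤ ph x') ∧ w.length ≤ R ∧ wt e ≤ 1

/-- A node of a derivation: source state, consumed stack word, target state, and yield. -/
structure GenNode (X Γ : Type) where
  src : X
  stk : List Γ
  tgt : X
  yld : ℕ → ℕ

section Pumping

variable {X Γ : Type} {Move : X → Γ → X → List Γ → (ℕ → ℕ) → Prop} {ph : X → ℕ} {R : ℕ}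

namespace Gen

theorem uncons {x z : X} {A : Γ} {s : List Γ} {v : ℕ → ℕ} (h : Gen Move x (A :: s) z v) :
    ∃ y u u', Gen Move x [A] y u ∧ Gen Move y s z u' ∧ v = u + u' := by
  cases h with
  | cons h₁ h₂ => exact ⟨_, _, _, h₁, h₂, rfl⟩
  | step hm h' => exact ⟨_, _, _, step hm h', nil _, (add_zero _).symm⟩

theorem split_append {x z : X} {s t : List Γ} {v : ℕ → ℕ} (h : Gen Move x (s ++ t) z v) :
    ∃ y u u', Gen Move x s y u ∧ Gen Move y t z u' ∧ v = u + u' := by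
  induction s generalizing x v with
  | nil => exact ⟨x, 0, v, nil x, h, (zero_add v).symm⟩
  | cons A s ih =>
    obtain ⟨y, u, u', h₁, h₂, rfl⟩ := uncons h
    obtain ⟨y', a, b, h₃, h₄, rfl⟩ := ih h₂
    exact ⟨y', u + a, b, cons h₁ h₃, h₄, (add_assoc _ _ _).symm⟩

theorem move_cons {x x' z : X} {A : Γ} {w s : List Γ} {e v : ℕ → ℕ}
    (hm : Move x A x' w e) (h : Gen Move x' (w ++ s) z v) :
    Gen Move x (A :: s) z (e + v) := by
  obtain ⟨y, u, u', h₁, h₂, rfl⟩ := split_append h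
  rw [← add_assoc]
  exact cons (step hm h₁) h₂

theorem phase (hM : Phased Move ph R) {x y : X} {s : List Γ} {v : ℕ → ℕ}
    (h : Gen Move x s y v) : ph x ≤ ph y ∧ ∀ k, v k ≠ 0 → ph x ≤ k ∧ k ≤ ph y := by
  induction h with
  | nil x => simp
  | @cons x y z A s u v _ _ ih₁ ih₂ =>
    refine ⟨ih₁.1.trans ih₂.1, fun k hk => ?_⟩
    have h₁ := ih₁.2 k
    have h₂ := ih₂.2 k
    simp only [Pi.add_apply] at hk
    omega
  | @step x x' y A w e v hm _ ih =>
    obtain ⟨hp, he, -, -⟩ := hM _ _ _ _ _ hm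
    refine ⟨hp.trans ih.1, fun k hk => ?_⟩
    have h₁ := he k
    have h₂ := ih.2 k
    simp only [Pi.add_apply] at hk
    omega

end Gen

/-- The node `b` occurs inside a derivation of the node `a`, and may be replaced there by any
other derivation with the same end points. -/
def Occurs (Move : X → Γ → X → List Γ → (ℕ → ℕ) → Prop) (ph : X → ℕ) (R : ℕ)
    (a b : GenNode X Γ) : Prop :=
  b.stk.length ≤ R ∧ Gen Move b.src b.stk b.tgt b.yld ∧
  ph a.src ≤ ph b.src ∧ ph b.tgt ≤ ph a.tgt ∧
  ∃ δ : ℕ → ℕ, a.yld = δ + b.yld ∧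
    (∀ w, Gen Move b.src b.stk b.tgt w → Gen Move a.src a.stk a.tgt (δ + w)) ∧
    ∀ k, δ k ≠ 0 → (ph a.src ≤ k ∧ k ≤ ph b.src) ∨ (ph b.tgt ≤ k ∧ k ≤ ph a.tgt)

theorem Occurs.trans {a b c : GenNode X Γ} (hab : Occurs Move ph R a b)
    (hbc : Occurs Move ph R b c) : Occurs Move ph R a c := by
  obtain ⟨-, -, h₁, h₂, δ, hδ, hr, hs⟩ := hab
  obtain ⟨hl, hg, h₁', h₂', δ', hδ', hr', hs'⟩ := hbc
  refine ⟨hl, hg, h₁.trans h₁', h₂'.trans h₂, δ + δ', ?_, fun w hw => ?_, fun k hk => ?_⟩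
  · rw [hδ, hδ', add_assoc]
  · rw [add_assoc]
    exact hr _ (hr' _ hw)
  · have := hs k
    have := hs' k
    simp only [Pi.add_apply] at hk
    omega

theorem Occurs.refl {x y : X} {s : List Γ} {v : ℕ → ℕ} (hs : s.length ≤ R)
    (h : Gen Move x s y v) : Occurs Move ph R ⟨x, s, y, v⟩ ⟨x, s, y, v⟩ :=
  ⟨hs, h, le_rfl, le_rfl, 0, (zero_add _).symm, fun w hw => by rwa [zero_add], by simp⟩

theorem occurs_cons_left (hM : Phased Move ph R) {x y z : X} {A : Γ} {s : List Γ}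
    {u v : ℕ → ℕ} (hs : (A :: s).length ≤ R) (h₁ : Gen Move x [A] y u)
    (h₂ : Gen Move y s z v) :
    Occurs Move ph R ⟨x, A :: s, z, u + v⟩ ⟨x, [A], y, u⟩ := by
  have hp := h₂.phase hM
  refine ⟨?_, h₁, le_rfl, hp.1, v, add_comm _ _, fun w hw => ?_, fun k hk => Or.inr (hp.2 k hk)⟩
  · simp only [List.length_cons, List.length_nil] at hs ⊢; omega
  · change Gen Move x (A :: s) z (v + w)
    rw [add_comm]
    exact .cons hw h₂

theorem occurs_cons_right (hM : Phased Move ph R) {x y z : X} {A : Γ} {s : List Γ}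
    {u v : ℕ → ℕ} (hs : (A :: s).length ≤ R) (h₁ : Gen Move x [A] y u)
    (h₂ : Gen Move y s z v) :
    Occurs Move ph R ⟨x, A :: s, z, u + v⟩ ⟨y, s, z, v⟩ := by
  have hp := h₁.phase hM
  refine ⟨?_, h₂, hp.1, le_rfl, u, rfl, fun w hw => .cons h₁ hw, fun k hk => Or.inl (hp.2 k hk)⟩
  simp only [List.length_cons] at hs ⊢; omega

theorem occurs_step (hM : Phased Move ph R) {x x' y : X} {A : Γ} {w : List Γ}
    {e v : ℕ → ℕ} (hm : Move x A x' w e) (h : Gen Move x' w y v) :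
    Occurs Move ph R ⟨x, [A], y, e + v⟩ ⟨x', w, y, v⟩ := by
  obtain ⟨hp, he, hw, -⟩ := hM _ _ _ _ _ hm
  exact ⟨hw, h, hp, le_rfl, e, rfl, fun u hu => .step hm hu, fun k hk => Or.inl (he k hk)⟩

/-- A derivation of weight at least `m` has a node of weight between `m` and `2 * m`. -/
theorem exists_occurs_window (hM : Phased Move ph R) {m : ℕ} (hm : 1 ≤ m) {x y : X}
    {s : List Γ} {v : ℕ → ℕ} (h : Gen Move x s y v) (hs : s.length ≤ R) (hv : m ≤ wt v) :
    ∃ b, Occurs Move ph R ⟨x, s, y, v⟩ b ∧ m ≤ wt b.yld ∧ wt b.yld ≤ 2 * m := by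
  induction h with
  | nil x => simp only [wt, Pi.zero_apply] at hv; omega
  | @cons x y z A s u v h₁ h₂ ih₁ ih₂ =>
    have hl := occurs_cons_left hM hs h₁ h₂
    have hr := occurs_cons_right hM hs h₁ h₂
    by_cases hu : m ≤ wt u
    · obtain ⟨b, hb, hb'⟩ := ih₁ hl.1 hu
      exact ⟨b, hl.trans hb, hb'⟩
    by_cases hv' : m ≤ wt v
    · obtain ⟨b, hb, hb'⟩ := ih₂ hr.1 hv'
      exact ⟨b, hr.trans hb, hb'⟩
    refine ⟨_, .refl hs (.cons h₁ h₂), hv, ?_⟩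
    simp only [wt_add]; omega
  | @step x x' y A w e v hmv h ih =>
    have ho := occurs_step hM hmv h
    by_cases hv' : m ≤ wt v
    · obtain ⟨b, hb, hb'⟩ := ih ho.1 hv'
      exact ⟨b, ho.trans hb, hb'⟩
    refine ⟨_, .refl hs (.step hmv h), hv, ?_⟩
    have := (hM _ _ _ _ _ hmv).2.2.2
    simp only [wt_add]; omega

/-- Proper occurrence: the weight decreases. -/
def POccurs (Move : X → Γ → X → List Γ → (ℕ → ℕ) → Prop) (ph : X → ℕ) (R : ℕ)
    (a b : GenNode X Γ) : Prop :=
  Occurs Move ph R a b ∧ wt b.yld < wt a.yld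

theorem Occurs.trans_pOccurs {a b c : GenNode X Γ} (hab : Occurs Move ph R a b)
    (hbc : POccurs Move ph R b c) : POccurs Move ph R a c := by
  refine ⟨hab.trans hbc.1, hbc.2.trans_le ?_⟩
  obtain ⟨-, -, -, -, δ, hδ, -, -⟩ := hab
  rw [hδ, wt_add]
  exact Nat.le_add_left _ _

/-- A node of weight at least `2 ^ k` heads a chain of `k` proper occurrences. -/
theorem exists_chain (hM : Phased Move ph R) {x y : X} {s : List Γ} {v : ℕ → ℕ}
    (h : Gen Move x s y v) (hs : s.length ≤ R) (k : ℕ) (hv : 2 ^ k ≤ wt v) :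
    ∃ l : List (GenNode X Γ), l.length = k ∧
      (⟨x, s, y, v⟩ :: l : List (GenNode X Γ)).Pairwise (POccurs Move ph R) := by
  have key : ∀ (a b : GenNode X Γ) (k : ℕ), Occurs Move ph R a b →
      (∀ j, 2 ^ j ≤ wt b.yld → ∃ l : List (GenNode X Γ), l.length = j ∧
        (b :: l).Pairwise (POccurs Move ph R)) →
      (wt a.yld ≤ wt b.yld ∧ 2 ^ k ≤ wt b.yld ∨
        wt b.yld < wt a.yld ∧ 2 ^ k ≤ 2 * wt b.yld) →
      ∃ l : List (GenNode X Γ), l.length = k ∧ (a :: l).Pairwise (POccurs Move ph R) := by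
    intro a b k hab ih hk
    rcases hk with ⟨-, hk⟩ | ⟨hlt, hk⟩
    · obtain ⟨l, hl, hp⟩ := ih k hk
      rw [List.pairwise_cons] at hp
      exact ⟨l, hl, List.pairwise_cons.2 ⟨fun c hc => hab.trans_pOccurs (hp.1 c hc), hp.2⟩⟩
    · cases k with
      | zero => exact ⟨[], rfl, List.pairwise_singleton _ _⟩
      | succ k =>
        obtain ⟨l, hl, hp⟩ := ih k (by rw [pow_succ] at hk; omega)
        refine ⟨b :: l, by simp [hl], List.pairwise_cons.2 ⟨fun c hc => ?_, hp⟩⟩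
        rcases List.mem_cons.1 hc with rfl | hc
        · exact ⟨hab, hlt⟩
        · exact hab.trans_pOccurs ((List.pairwise_cons.1 hp).1 c hc)
  induction h generalizing k with
  | nil x =>
    have := Nat.one_le_two_pow (n := k)
    simp only [wt, Pi.zero_apply] at hv
    omega
  | @cons x y z A s u v h₁ h₂ ih₁ ih₂ =>
    have hl := occurs_cons_left hM hs h₁ h₂
    have hr := occurs_cons_right hM hs h₁ h₂
    rw [wt_add] at hv
    by_cases hc : wt v ≤ wt u
    · refine key _ _ k hl (fun j hj => ih₁ hl.1 j hj) ?_
      simp only [wt_add]; omega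
    · refine key _ _ k hr (fun j hj => ih₂ hr.1 j hj) ?_
      simp only [wt_add]; omega
  | @step x x' y A w e v hmv h ih =>
    have ho := occurs_step hM hmv h
    have he := (hM _ _ _ _ _ hmv).2.2.2
    rw [wt_add] at hv
    by_cases h0 : wt v = 0
    · have hk : k = 0 := by
        by_contra hk
        have := Nat.pow_le_pow_right (n := 2) (by norm_num) (Nat.one_le_iff_ne_zero.2 hk)
        omega
      subst hk
      exact ⟨[], rfl, List.pairwise_singleton _ _⟩
    · refine key _ _ k ho (fun j hj => ih ho.1 j hj) ?_
      simp only [wt_add]; omega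

/-- A crossing equality `v 0 = v 2`, `v 1 = v 3` cannot be enforced by a pushdown system. -/
theorem exists_forall_not_gen [Finite X] [Finite Γ] (hM : Phased Move ph R) :
    ∃ p : ℕ, ∀ n, p ≤ n → ∀ x s y, s.length ≤ R →
      (∀ v, Gen Move x s y v → v 0 = v 2 ∧ v 1 = v 3) →
      ¬ Gen Move x s y (fun k => if k < 4 then n else 0) := by
  classical
  have hfin : Finite {s : List Γ // s.length ≤ R} := (List.finite_length_le Γ R).to_subtype
  let N := X × {s : List Γ // s.length ≤ R} × X
  have : Fintype N := Fintype.ofFinite N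
  let K := 2 ^ Fintype.card N
  have hK : 1 ≤ K := Nat.one_le_two_pow
  refine ⟨2 * K + 1, fun n hn x s y hs hcross hgen => ?_⟩
  obtain ⟨a, hoa, hal, hau⟩ := exists_occurs_window hM hK hgen hs
    (by simp only [wt]; norm_num; omega)
  obtain ⟨l, hl, hp⟩ := exists_chain hM hoa.2.1 hoa.1 (Fintype.card N) hal
  have hself : ∀ b ∈ a :: l, b = a ∨ Occurs Move ph R a b := fun b hb =>
    (List.mem_cons.1 hb).imp_right fun h => ((List.pairwise_cons.1 hp).1 b h).1
  have hlen : ∀ b ∈ a :: l, b.stk.length ≤ R := fun b hb =>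
    (hself b hb).elim (fun h => h ▸ hoa.1) (fun h => h.1)
  obtain ⟨b, hb, c, hc, hbc, hs₁, hs₂, hs₃⟩ : ∃ b ∈ a :: l, ∃ c ∈ a :: l,
      POccurs Move ph R b c ∧ b.src = c.src ∧ b.stk = c.stk ∧ b.tgt = c.tgt := by
    by_contra! hno
    have hnd : ((a :: l).attach.map fun b =>
        ((b.1.src, ⟨b.1.stk, hlen b.1 b.2⟩, b.1.tgt) : N)).Nodup := by
      rw [List.Nodup, List.pairwise_map]
      rw [← List.attach_map_subtype_val (a :: l), List.pairwise_map] at hp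
      refine hp.imp ?_
      intro b c hbc he
      simp only [Prod.mk.injEq, Subtype.mk.injEq] at he
      exact hno b.1 b.2 c.1 c.2 hbc he.1 he.2.1 he.2.2
    have := hnd.length_le_card
    rw [List.length_map, List.length_attach, List.length_cons, hl] at this
    exact Nat.not_succ_le_self _ this
  have hob : Occurs Move ph R ⟨x, s, y, fun k => if k < 4 then n else 0⟩ b :=
    (hself b hb).elim (fun h => h ▸ hoa) (fun h => hoa.trans h)
  have hbK : wt b.yld ≤ 2 * K := by
    rcases hself b hb with rfl | h
    · exact hau
    · obtain ⟨-, -, -, -, δ, hδ, -, -⟩ := h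
      rw [hδ, wt_add] at hau
      omega
  obtain ⟨-, -, -, -, δ₀, hδ₀, hr₀, hp₀⟩ := hob
  obtain ⟨⟨-, hgc, -, -, δ, hδ, -, hpδ⟩, hlt⟩ := hbc
  have hph := (hgc.phase hM).1
  have hgen' := hcross _ (hr₀ c.yld (by rw [hs₁, hs₂, hs₃]; exact hgc))
  rw [hδ, wt_add] at hlt hbK
  have e : ∀ k, k < 4 → n = δ₀ k + (δ k + c.yld k) := fun k hk => by
    have := congrFun hδ₀ k
    simpa [hδ, hk] using this
  have e0 := e 0 (by norm_num)
  have e1 := e 1 (by norm_num)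
  have e2 := e 2 (by norm_num)
  have e3 := e 3 (by norm_num)
  have p1 := hp₀ 1
  have p2 := hp₀ 2
  have d0 := hpδ 0
  have d1 := hpδ 1
  have d2 := hpδ 2
  have d3 := hpδ 3
  simp only [hs₁, hs₃] at d0 d1 d2 d3 p1 p2
  simp only [wt, Pi.add_apply] at hgen' hlt hbK
  omega

end Pumping

section Control

variable {Q α Γ C : Type}

namespace DPDA

/-- From the configuration `c` the machine reaches a state in `F`. -/
def Reaches (M : DPDA Q α Γ) (F : Set Q) (c : Cfg Q α Γ) : Prop :=
  ∃ n c', M.stepN n c = some c' ∧ c'.st ∈ F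

variable {M : DPDA Q α Γ} {F : Set Q}

theorem stepN_add (m n : ℕ) (c : Cfg Q α Γ) :
    M.stepN (m + n) c = (M.stepN m c).bind (M.stepN n) := by
  induction m generalizing c with
  | zero => simp [stepN]
  | succ m ih =>
    rw [Nat.succ_add]
    cases h : M.step c with
    | none => simp [stepN, h]
    | some d => simp [stepN, h, ih]

theorem stepN_trans {m n : ℕ} {a b c : Cfg Q α Γ} (hab : M.stepN m a = some b)
    (hbc : M.stepN n b = some c) : M.stepN (m + n) a = some c := by
  rw [stepN_add, hab]; exact hbc

theorem Reaches.of_stepN {n : ℕ} {a b : Cfg Q α Γ} (hab : M.stepN n a = some b)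
    (hb : M.Reaches F b) : M.Reaches F a :=
  let ⟨_, c, hc, hF⟩ := hb
  ⟨_, c, stepN_trans hab hc, hF⟩

theorem Reaches.of_mem {c : Cfg Q α Γ} (h : c.st ∈ F) : M.Reaches F c := ⟨0, c, rfl, h⟩

theorem step_eps {q p : Q} {A : Γ} {w s : List Γ} {i : List (TSym α)}
    (h : M.δ q none A = some (p, w)) : M.step ⟨q, i, A :: s⟩ = some ⟨p, i, w ++ s⟩ := by
  simp [step, h]

theorem step_read {q p : Q} {A : Γ} {w s : List Γ} {t : TSym α} {i : List (TSym α)}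
    (h₀ : M.δ q none A = none) (h : M.δ q (some t) A = some (p, w)) :
    M.step ⟨q, t :: i, A :: s⟩ = some ⟨p, i, w ++ s⟩ := by
  simp [step, h₀, h]

end DPDA

/-- Paths of a control automaton whose edges read at most one tape symbol and carry a yield. -/
inductive Path (Edge : C → Option (TSym α) → C → (ℕ → ℕ) → Prop) :
    C → C → List (TSym α) → (ℕ → ℕ) → Prop
  | nil (c : C) : Path Edge c c [] 0
  | jump {c d c' : C} {e v : ℕ → ℕ} {w : List (TSym α)} :
      Edge c none d e → Path Edge d c' w v → Path Edge c c' w (e + v)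
  | read {c d c' : C} {t : TSym α} {e v : ℕ → ℕ} {w : List (TSym α)} :
      Edge c (some t) d e → Path Edge d c' w v → Path Edge c c' (t :: w) (e + v)

/-- The moves of the product of a 1dpda, a control automaton, and a final phase, entered in the
states of `F`, which reads the remaining tape and empties the stack.  The symbol `none` is a
bottom marker that the 1dpda never touches. -/
inductive ProdMove (M : DPDA Q α Γ) (F : Set Q)
    (Edge : C → Option (TSym α) → C → (ℕ → ℕ) → Prop) :
    Q × C → Option Γ → Q × C → List (Option Γ) → (ℕ → ℕ) → Prop
  | jump {q : Q} {c d : C} {A : Option Γ} {e : ℕ → ℕ} :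
      Edge c none d e → ProdMove M F Edge (q, c) A (q, d) [A] e
  | eps {q p : Q} {c : C} {A : Γ} {w : List Γ} :
      M.δ q none A = some (p, w) → ProdMove M F Edge (q, c) (some A) (p, c) (w.map some) 0
  | read {q p : Q} {c d : C} {A : Γ} {w : List Γ} {t : TSym α} {e : ℕ → ℕ} :
      M.δ q none A = none → M.δ q (some t) A = some (p, w) → Edge c (some t) d e →
      ProdMove M F Edge (q, c) (some A) (p, d) (w.map some) e
  | pop {q : Q} {c : C} {A : Option Γ} : q ∈ F → ProdMove M F Edge (q, c) A (q, c) [] 0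
  | skip {q : Q} {c d : C} {A : Option Γ} {t : TSym α} {e : ℕ → ℕ} :
      q ∈ F → Edge c (some t) d e → ProdMove M F Edge (q, c) A (q, d) [A] e

variable {M : DPDA Q α Γ} {F : Set Q} {Edge : C → Option (TSym α) → C → (ℕ → ℕ) → Prop}

theorem Path.append {a b c : C} {w w' : List (TSym α)} {v v' : ℕ → ℕ}
    (h : Path Edge a b w v) (h' : Path Edge b c w' v') : Path Edge a c (w ++ w') (v + v') := by
  induction h with
  | nil => simpa using h'
  | jump he _ ih => rw [add_assoc]; exact .jump he (ih h')
  | read he _ ih => rw [add_assoc]; exact .read he (ih h')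

theorem Gen.exists_path {x y : Q × C} {s : List (Option Γ)} {v : ℕ → ℕ}
    (h : Gen (ProdMove M F Edge) x s y v) :
    ∃ w, Path Edge x.2 y.2 w v ∧ ∀ i u,
      (∃ n, M.stepN n ⟨x.1, w ++ i, s.reduceOption ++ u⟩ = some ⟨y.1, i, u⟩) ∨
        M.Reaches F ⟨x.1, w ++ i, s.reduceOption ++ u⟩ := by
  induction h with
  | nil x => exact ⟨[], .nil _, fun i u => Or.inl ⟨0, rfl⟩⟩
  | @cons x y z A s v v' _ _ ih₁ ih₂ =>
    obtain ⟨w₁, hp₁, h₁⟩ := ih₁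
    obtain ⟨w₂, hp₂, h₂⟩ := ih₂
    refine ⟨w₁ ++ w₂, hp₁.append hp₂, fun i u => ?_⟩
    have hs : (A :: s).reduceOption ++ u = [A].reduceOption ++ (s.reduceOption ++ u) := by
      rw [← List.append_assoc, ← List.reduceOption_append]; rfl
    rw [hs, List.append_assoc]
    rcases h₁ (w₂ ++ i) (s.reduceOption ++ u) with ⟨n, hn⟩ | hr
    · rcases h₂ i u with ⟨m, hm⟩ | hr
      · exact Or.inl ⟨_, DPDA.stepN_trans hn hm⟩
      · exact Or.inr (.of_stepN hn hr)
    · exact Or.inr hr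
  | @step x x' y A s e v hm _ ih =>
    obtain ⟨w, hp, h⟩ := ih
    have hstep : ∀ {a b : Cfg Q α Γ} {i u}, M.step a = some b →
        ((∃ n, M.stepN n b = some ⟨y.1, i, u⟩) ∨ M.Reaches F b) →
        (∃ n, M.stepN n a = some ⟨y.1, i, u⟩) ∨ M.Reaches F a := by
      intro a b i u hab hb
      have h1 : M.stepN 1 a = some b := by simp [DPDA.stepN, hab]
      rcases hb with ⟨n, hn⟩ | hr
      · exact Or.inl ⟨_, DPDA.stepN_trans h1 hn⟩
      · exact Or.inr (.of_stepN h1 hr)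
    have hred : ∀ l : List Γ, (l.map some).reduceOption = l := fun l => by
      simp [List.reduceOption]
    cases hm with
    | jump he => exact ⟨w, .jump he hp, h⟩
    | eps hδ =>
      refine ⟨w, by simpa using hp, fun i u => hstep (DPDA.step_eps hδ) ?_⟩
      simpa [hred] using h i u
    | @read q p c d A l t e h₀ hδ he =>
      refine ⟨t :: w, .read he hp, fun i u => hstep (DPDA.step_read h₀ hδ) ?_⟩
      simpa [hred] using h i u
    | pop hq => exact ⟨w, by simpa using hp, fun i u => Or.inr (.of_mem hq)⟩
    | @skip q c d A t e hq he => exact ⟨t :: w, .read he hp, fun i u => Or.inr (.of_mem hq)⟩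

theorem exists_gen_of_mem {q : Q} (hq : q ∈ F) {c c' : C} {w : List (TSym α)} {v : ℕ → ℕ}
    (h : Path Edge c c' w v) (s : List (Option Γ)) (hs : s ≠ []) :
    Gen (ProdMove M F Edge) (q, c) s (q, c') v := by
  obtain ⟨A, s, rfl⟩ := List.exists_cons_of_ne_nil hs
  induction h with
  | nil c =>
    clear hs
    induction s generalizing A with
    | nil => exact add_zero (0 : ℕ → ℕ) ▸ .move_cons (.pop hq) (.nil _)
    | cons B s ih => exact add_zero (0 : ℕ → ℕ) ▸ .move_cons (.pop hq) (ih B)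
  | jump he _ ih => exact .move_cons (.jump he) ih
  | read he _ ih => exact .move_cons (.skip hq he) ih

theorem exists_gen_of_stepN {n : ℕ} {q : Q} {w : List (TSym α)} {s : List Γ} {a : Cfg Q α Γ}
    (h : M.stepN n ⟨q, w, s⟩ = some a) (ha : a.st ∈ F) {c c' : C} {v : ℕ → ℕ}
    (hp : Path Edge c c' w v) :
    ∃ q' ∈ F, Gen (ProdMove M F Edge) (q, c) (s.map some ++ [none]) (q', c') v := by
  induction n generalizing q w s c v with
  | zero =>
    obtain rfl : _ = a := Option.some.inj h
    exact ⟨q, ha, exists_gen_of_mem ha hp _ (by simp)⟩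
  | succ n ih =>
    cases s with
    | nil => simp [DPDA.stepN, DPDA.step] at h
    | cons A s =>
      cases h₀ : M.δ q none A with
      | some pl =>
        obtain ⟨p, l⟩ := pl
        rw [DPDA.stepN, DPDA.step_eps h₀] at h
        obtain ⟨q', hq', hg⟩ := ih h hp
        refine ⟨q', hq', zero_add v ▸ .move_cons (.eps h₀) ?_⟩
        simpa using hg
      | none =>
        induction hp with
        | nil c => simp [DPDA.stepN, DPDA.step, h₀] at h
        | jump he _ ihp =>
          obtain ⟨q', hq', hg⟩ := ihp @ih h
          exact ⟨q', hq', .move_cons (.jump he) hg⟩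
        | @read c d c' t e v w he hp _ =>
          cases hδ : M.δ q (some t) A with
          | none => simp [DPDA.stepN, DPDA.step, h₀, hδ] at h
          | some pl =>
            obtain ⟨p, l⟩ := pl
            rw [DPDA.stepN, DPDA.step_read h₀ hδ] at h
            obtain ⟨q', hq', hg⟩ := ih h hp
            refine ⟨q', hq', .move_cons (.read h₀ hδ he) ?_⟩
            simpa using hg

instance {α : Type} [Finite α] : Finite (TSym α) := by
  refine Finite.of_injective
    (fun t : TSym α => (match t with
      | .lend => none
      | .rend => some none
      | .ch a => some (some a) : Option (Option α))) ?_
  rintro (_ | _ | _) (_ | _ | _) <;> simp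

theorem exists_forall_length_le [Finite Q] [Finite α] [Finite Γ] (M : DPDA Q α Γ) :
    ∃ R, ∀ q t A p w, M.δ q t A = some (p, w) → w.length ≤ R := by
  obtain ⟨R, hR⟩ := Finite.bddAbove_range fun x : Q × Option (TSym α) × Γ =>
    (M.δ x.1 x.2.1 x.2.2).elim 0 fun y => y.2.length
  refine ⟨R, fun q t A p w h => ?_⟩
  simpa [h] using hR (Set.mem_range_self (q, t, A))

/-- On the inputs generated by a phased control automaton, a 1dpda cannot enforce a crossing
equality of the yields. -/
theorem exists_forall_not_reaches [Finite Q] [Finite α] [Finite Γ] [Finite C]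
    (M : DPDA Q α Γ) (F : Set Q) (ph : C → ℕ)
    (hE : ∀ c t d e, Edge c t d e →
      ph c ≤ ph d ∧ (∀ k, e k ≠ 0 → ph c ≤ k ∧ k ≤ ph d) ∧ wt e ≤ 1) (c c' : C) :
    ∃ p : ℕ, ∀ n, p ≤ n →
      (∀ w v, Path Edge c c' w v → M.Reaches F ⟨M.q0, w, [M.Z0]⟩ → v 0 = v 2 ∧ v 1 = v 3) →
      ∀ w, Path Edge c c' w (fun k => if k < 4 then n else 0) →
        ¬ M.Reaches F ⟨M.q0, w, [M.Z0]⟩ := by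
  obtain ⟨R, hR⟩ := exists_forall_length_le M
  have hph : Phased (ProdMove M F Edge) (fun x => ph x.2) (R + 2) := by
    intro x A x' w e hm
    cases hm with
    | jump he =>
      obtain ⟨h₁, h₂, h₃⟩ := hE _ _ _ _ he
      exact ⟨h₁, h₂, by simp, h₃⟩
    | eps hδ =>
      have := hR _ _ _ _ _ hδ
      exact ⟨le_rfl, by simp, by simp; omega, by simp [wt]⟩
    | read h₀ hδ he =>
      obtain ⟨h₁, h₂, h₃⟩ := hE _ _ _ _ he
      have := hR _ _ _ _ _ hδ
      exact ⟨h₁, h₂, by simp; omega, h₃⟩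
    | pop hq => exact ⟨le_rfl, by simp, by simp, by simp [wt]⟩
    | skip hq he =>
      obtain ⟨h₁, h₂, h₃⟩ := hE _ _ _ _ he
      exact ⟨h₁, h₂, by simp, h₃⟩
  obtain ⟨p, hp⟩ := exists_forall_not_gen hph
  refine ⟨p, fun n hn hcross w hw hr => ?_⟩
  obtain ⟨m, a, ha, haF⟩ := hr
  obtain ⟨q', hq', hg⟩ := exists_gen_of_stepN ha haF hw
  refine hp n hn _ _ _ (by simp) (fun v hv => ?_) hg
  obtain ⟨w', hw', h⟩ := hv.exists_path
  refine hcross w' v hw' ?_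
  have h := h [] []
  simp only [List.append_nil, List.map_cons, List.map_nil, List.cons_append, List.nil_append,
    List.reduceOption_cons_of_some, List.reduceOption_cons_of_none, List.reduceOption_nil] at h
  rcases h with ⟨k, hk⟩ | h
  · exact ⟨k, _, hk, hq'⟩
  · exact h

end Control

section BlockControl

variable {α : Type}

/-- The edges of the control automaton generating
`P 0 ++ rep (X 0) (v 0) ++ P 1 ++ ⋯ ++ rep (X 3) (v 3) ++ P 4`.  A state holds the current phase
and the part of the current block that is still to be read. -/
inductive BlockEdge (P X : ℕ → List (TSym α)) :
    ℕ × List (TSym α) → Option (TSym α) → ℕ × List (TSym α) → (ℕ → ℕ) → Prop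
  | letter (i : ℕ) (a : TSym α) (r : List (TSym α)) : BlockEdge P X (i, a :: r) (some a) (i, r) 0
  | loop (i : ℕ) : i < 4 → BlockEdge P X (i, []) none (i, X i) (Pi.single i 1)
  | next (i : ℕ) : i < 4 → BlockEdge P X (i, []) none (i + 1, P (i + 1)) 0

/-- The states of the block control automaton with buffers of length at most `L`. -/
abbrev BlockState (α : Type) (L : ℕ) : Type :=
  {c : ℕ × List (TSym α) // c.1 ≤ 4 ∧ c.2.length ≤ L}

/-- The edges between the states with bounded buffers. -/
abbrev BufferEdge (P X : ℕ → List (TSym α)) (L : ℕ) (c : BlockState α L) (t : Option (TSym α))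
    (d : BlockState α L) (e : ℕ → ℕ) : Prop :=
  BlockEdge P X c.1 t d.1 e

/-- The part of the block word read from the beginning of the loop of phase `i` on. -/
def tailWord (P X : ℕ → List (TSym α)) (i : ℕ) (v : ℕ → ℕ) : List (TSym α) :=
  (List.range' i (4 - i)).flatMap fun j => rep (X j) (v j) ++ P (j + 1)

/-- The word with blocks `P i` separated by repetitions of the `X i`. -/
def blockWord (P X : ℕ → List (TSym α)) (v : ℕ → ℕ) : List (TSym α) :=
  P 0 ++ (rep (X 0) (v 0) ++ (P 1 ++ (rep (X 1) (v 1) ++ (P 2 ++ (rep (X 2) (v 2) ++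
    (P 3 ++ (rep (X 3) (v 3) ++ P 4)))))))

variable {P X : ℕ → List (TSym α)} {L : ℕ}

theorem rep_succ {β : Type} (x : List β) (n : ℕ) : rep x (n + 1) = x ++ rep x n := by
  simp [rep, List.replicate_succ]

theorem tailWord_of_lt {i : ℕ} (hi : i < 4) (v : ℕ → ℕ) :
    tailWord P X i v = rep (X i) (v i) ++ (P (i + 1) ++ tailWord P X (i + 1) v) := by
  obtain ⟨k, hk⟩ : ∃ k, 4 - i = k + 1 := ⟨3 - i, by omega⟩
  have hk' : 4 - (i + 1) = k := by omega
  simp [tailWord, hk, hk', List.range'_succ]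

theorem tailWord_congr {i : ℕ} {v v' : ℕ → ℕ} (h : ∀ j, i ≤ j → v j = v' j) :
    tailWord P X i v = tailWord P X i v' := by
  unfold tailWord
  refine List.flatMap_congr fun j hj => ?_
  rw [h j (List.mem_range'_1.1 hj).1]

theorem append_tailWord_zero (v : ℕ → ℕ) :
    P 0 ++ tailWord P X 0 v = blockWord P X v := by
  rw [tailWord_of_lt (by norm_num), tailWord_of_lt (by norm_num), tailWord_of_lt (by norm_num),
    tailWord_of_lt (by norm_num)]
  simp [blockWord, tailWord]

theorem eq_tailWord_of_path {c c' : BlockState α L} {w : List (TSym α)} {v : ℕ → ℕ}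
    (h : Path (BufferEdge P X L) c c' w v) (hc' : c'.1 = (4, [])) :
    w = c.1.2 ++ tailWord P X c.1.1 v ∧ ∀ k, v k ≠ 0 → c.1.1 ≤ k := by
  induction h with
  | nil c => simp [hc', tailWord]
  | @jump c d c' e v w he _ ih =>
    obtain ⟨rfl, hv⟩ := ih hc'
    obtain ⟨c, hc⟩ := c
    obtain ⟨d, hd⟩ := d
    simp only at he hv ⊢
    cases he with
    | loop i hi =>
      refine ⟨?_, fun k hk => ?_⟩
      · rw [tailWord_of_lt hi, tailWord_of_lt hi]
        rw [tailWord_congr (i := i + 1) (v := Pi.single i 1 + v) (v' := v)]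
        · simp [Nat.add_comm 1, rep_succ]
        · intro j hj
          have : j ≠ i := by omega
          simp [this]
      · by_contra hlt
        have hki : k ≠ i := by rintro rfl; exact hlt le_rfl
        exact hlt (hv k (by simpa [hki] using hk))
    | next i hi =>
      have hvi : v i = 0 := by
        by_contra h
        have := hv i h
        simp at this
      refine ⟨?_, fun k hk => ?_⟩
      · simp [tailWord_of_lt hi, hvi, rep]
      · have := hv k (by simpa using hk)
        simp only at this ⊢; omega
  | @read c d c' t e v w he _ ih =>
    obtain ⟨rfl, hv⟩ := ih hc'
    obtain ⟨c, hc⟩ := c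
    obtain ⟨d, hd⟩ := d
    simp only at he hv ⊢
    cases he with
    | letter i a r => exact ⟨by simp, fun k hk => hv k (by simpa using hk)⟩

theorem blockPath_read {i : ℕ} {r w : List (TSym α)} {v : ℕ → ℕ} {c' : BlockState α L}
    (hi : i ≤ 4) (hr : r.length ≤ L)
    (h : Path (BufferEdge P X L) ⟨(i, []), hi, Nat.zero_le _⟩ c' w v) :
    Path (BufferEdge P X L) ⟨(i, r), hi, hr⟩ c' (r ++ w) v := by
  induction r with
  | nil => exact h
  | cons a r ih =>
    have hr' : r.length ≤ L := by simp at hr; omega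
    exact zero_add v ▸ .read (d := ⟨(i, r), hi, hr'⟩) (.letter i a r) (ih hr')

theorem blockPath_step (hP : ∀ i, (P i).length ≤ L) (hX : ∀ i, (X i).length ≤ L) {i : ℕ}
    (hi : i < 4) (n : ℕ) {w : List (TSym α)} {v : ℕ → ℕ} {c' : BlockState α L}
    (h : Path (BufferEdge P X L) ⟨(i + 1, []), hi, Nat.zero_le _⟩ c' w v) :
    Path (BufferEdge P X L) ⟨(i, []), hi.le, Nat.zero_le _⟩ c'
      (rep (X i) n ++ (P (i + 1) ++ w)) (Pi.single i n + v) := by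
  induction n with
  | zero =>
    have := Path.jump (Edge := BufferEdge P X L)
      (c := ⟨(i, []), hi.le, Nat.zero_le _⟩) (.next i hi) (blockPath_read hi (hP _) h)
    simpa [rep] using this
  | succ n ih =>
    have := Path.jump (Edge := BufferEdge P X L)
      (c := ⟨(i, []), hi.le, Nat.zero_le _⟩) (.loop i hi) (blockPath_read hi.le (hX _) ih)
    rw [rep_succ, Nat.add_comm n 1, Pi.single_add, add_assoc, List.append_assoc]
    exact this

theorem blockPath (hP : ∀ i, (P i).length ≤ L) (hX : ∀ i, (X i).length ≤ L) (n : ℕ) :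
    Path (BufferEdge P X L)
      (⟨(0, P 0), Nat.zero_le _, hP 0⟩ : BlockState α L) ⟨(4, []), le_rfl, Nat.zero_le _⟩
      (blockWord P X fun k => if k < 4 then n else 0) (fun k => if k < 4 then n else 0) := by
  have h := blockPath_step hP hX (i := 0) (by norm_num) n <|
    blockPath_step hP hX (i := 1) (by norm_num) n <|
    blockPath_step hP hX (i := 2) (by norm_num) n <|
    blockPath_step hP hX (i := 3) (by norm_num) n (.nil _)
  have h := blockPath_read (r := P 0) (Nat.zero_le 4) (hP 0) h
  convert h using 1
  · simp [blockWord]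
  · funext k
    rcases k with _ | _ | _ | _ | k <;> simp

/-- A language that meets the block words exactly in a crossing equality is not a finite union of
languages, each described by reachability of a set of states of a 1dpda. -/
theorem ne_iUnion_reaches [Finite α] {ι : Type} [Fintype ι] {K : Set (List α)}
    {f : ι → Set (List α)} (x : (ℕ → ℕ) → List α)
    (hP : ∀ i, (P i).length ≤ L) (hX : ∀ i, (X i).length ≤ L)
    (hx : ∀ v, DPDA.tape (x v) = blockWord P X v)
    (hK : ∀ v, x v ∈ K → v 0 = v 2 ∧ v 1 = v 3)
    (hdiag : ∀ n, x (fun k => if k < 4 then n else 0) ∈ K)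
    (hf : ∀ i, ∃ (Q Γ : Type) (_ : Fintype Q) (_ : Fintype Γ) (M : DPDA Q α Γ) (F : Set Q),
      f i = {x | M.Reaches F (M.init x)}) :
    K ≠ ⋃ i, f i := by
  intro hKf
  have : Finite (BlockState α L) :=
    (((Set.finite_Iic 4).prod (List.finite_length_le (TSym α) L)).subset
      fun c hc => hc : {c : ℕ × List (TSym α) | c.1 ≤ 4 ∧ c.2.length ≤ L}.Finite).to_subtype
  have hpump : ∀ i, ∃ p : ℕ, ∀ n, p ≤ n → x (fun k => if k < 4 then n else 0) ∉ f i := by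
    intro i
    obtain ⟨Q, Γ, _, _, M, F, hfi⟩ := hf i
    obtain ⟨p, hp⟩ := exists_forall_not_reaches
      (Edge := BufferEdge P X L) M F (fun c => c.1.1)
      (by
        rintro ⟨c, hc⟩ t ⟨d, hd⟩ e he
        simp only at he ⊢
        cases he with
        | letter => simp [wt]
        | loop i hi =>
          refine ⟨le_rfl, fun k hk => ?_, ?_⟩
          · have : k = i := by
              by_contra h
              simp [h] at hk
            simp [this]
          · simp only [wt, Pi.single_apply]
            split_ifs <;> omega
        | next i hi => simp [wt])
      ⟨(0, P 0), Nat.zero_le _, hP 0⟩ ⟨(4, []), le_rfl, Nat.zero_le _⟩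
    refine ⟨p, fun n hn hmem => ?_⟩
    refine hp n hn (fun w v hw hr => ?_) _ (blockPath hP hX n) ?_
    · obtain ⟨rfl, -⟩ := eq_tailWord_of_path hw rfl
      refine hK v (hKf ▸ Set.mem_iUnion.2 ⟨i, ?_⟩)
      rw [hfi]
      change M.Reaches F ⟨M.q0, DPDA.tape (x v), [M.Z0]⟩
      rw [hx, ← append_tailWord_zero]
      exact hr
    · rw [hfi] at hmem
      rw [← hx]
      exact hmem
  choose p hp using hpump
  obtain ⟨i, hi⟩ := Set.mem_iUnion.1 (hKf ▸ hdiag (Finset.univ.sup p))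
  exact hp i _ (Finset.le_sup (Finset.mem_univ i)) hi

end BlockControl

section Words

/-- The words of `ws` separated by `#`. -/
abbrev sharpJoin (ws : List (List Bool)) : List (Option Bool) :=
  (List.intersperse [(none : Option Bool)]
    (ws.map fun w => w.map (some : Bool → Option Bool))).flatten

theorem sharpJoin_cons (w : List Bool) {ws : List (List Bool)} (h : ws ≠ []) :
    sharpJoin (w :: ws) = w.map some ++ none :: sharpJoin ws := by
  obtain ⟨u, us, rfl⟩ := List.exists_cons_of_ne_nil h
  simp [sharpJoin]

theorem sharpJoin_append {us ws : List (List Bool)} (hu : us ≠ []) (hw : ws ≠ []) :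
    sharpJoin (us ++ ws) = sharpJoin us ++ none :: sharpJoin ws := by
  induction us with
  | nil => exact absurd rfl hu
  | cons u us ih =>
    cases us with
    | nil => rw [List.singleton_append, sharpJoin_cons u hw]; simp [sharpJoin]
    | cons u' us =>
      rw [List.cons_append, sharpJoin_cons u (by simp), ih (by simp), sharpJoin_cons u (by simp)]
      simp

theorem sharpJoin_replicate_append (a : ℕ) (w : List Bool) {ws : List (List Bool)} (h : ws ≠ []) :
    sharpJoin (List.replicate a w ++ ws) = rep (w.map some ++ [none]) a ++ sharpJoin ws := by
  induction a with
  | zero => simp [rep]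
  | succ a ih =>
    rw [List.replicate_succ, List.cons_append, sharpJoin_cons w (by simp [h]), ih, rep_succ]
    simp

theorem sharpJoin_injective {us ws : List (List Bool)} (hu : us ≠ []) (hw : ws ≠ [])
    (h : sharpJoin us = sharpJoin ws) : us = ws := by
  have key : ∀ ws : List (List Bool), ws ≠ [] →
      (sharpJoin ws).splitOn none = ws.map fun w => w.map some := fun ws hw =>
    List.splitOn_intercalate none (by simp) (by simpa using hw)
  have hm := key us hu
  rw [h, key ws hw] at hm
  exact (List.map_injective_iff.2 (List.map_injective_iff.2 (Option.some_injective Bool)) hm).symm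

/-- The string `w₁#⋯#w_m##v₁#⋯#v_n`. -/
abbrev sharpWord (ws vs : List (List Bool)) : List (Option Bool) :=
  sharpJoin ws ++ [none, none] ++ sharpJoin vs

theorem sharpWord_eq_sharpJoin {ws vs : List (List Bool)} (hw : ws ≠ []) (hv : vs ≠ []) :
    sharpWord ws vs = sharpJoin (ws ++ [] :: vs) := by
  rw [sharpJoin_append hw (by simp), sharpJoin_cons [] hv]
  simp [sharpWord]

theorem sharpWord_mem_iff {ws vs : List (List Bool)} (hw : ws ≠ []) (hv : vs ≠ [])
    (hw' : [] ∉ ws) (hv' : [] ∉ vs) :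
    sharpWord ws vs ∈ MPalSharp ↔
      ∃ (i : ℕ) (w v : List Bool), ws[i]? = some w ∧ vs[i]? = some v ∧ v = w.reverse := by
  constructor
  · rintro ⟨us, xs, hu, hx, he, i, h₁, h₂, hi⟩
    change sharpWord ws vs = sharpWord us xs at he
    rw [sharpWord_eq_sharpJoin hw hv, sharpWord_eq_sharpJoin hu hx] at he
    have he := sharpJoin_injective (by simp) (by simp) he
    rw [List.append_cons_inj_of_notMem hw' hv'] at he
    obtain ⟨rfl, -, rfl⟩ := he
    exact ⟨i, _, _, List.getElem?_eq_getElem h₁, List.getElem?_eq_getElem h₂, by simpa using hi⟩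
  · rintro ⟨i, w, v, h₁, h₂, rfl⟩
    obtain ⟨hi, rfl⟩ := List.getElem?_eq_some_iff.1 h₁
    obtain ⟨hi', h⟩ := List.getElem?_eq_some_iff.1 h₂
    exact ⟨ws, vs, hw, hv, rfl, i, hi, hi', by simpa using h⟩

theorem map_rep {β γ : Type} (f : β → γ) (x : List β) (n : ℕ) :
    (rep x n).map f = rep (x.map f) n := by
  simp [rep]

theorem rep_singleton {β : Type} (b : β) (n : ℕ) : rep [b] n = List.replicate n b := by
  induction n with
  | zero => rfl
  | succ n ih => rw [rep_succ, ih]; rfl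

/-- A word that matches exactly when its two counters on either side agree. -/
def matchWord (v : ℕ → ℕ) : List (Option Bool) :=
  sharpWord (List.replicate (v 0) [false] ++ [List.replicate (v 1 + 1) true])
    (List.replicate (v 2) [false, false] ++ [List.replicate (v 3 + 1) true])

/-- A word that avoids all matches exactly when its two counters on either side agree. -/
def avoidWord (v : ℕ → ℕ) : List (Option Bool) :=
  sharpWord
    (List.replicate (v 0) [true] ++ (List.replicate (v 1 + 1) [false] ++ [[true]]))
    (List.replicate (v 2) [false] ++ (List.replicate (v 3 + 1) [true] ++ [[false]]))

theorem matchWord_mem_iff (v : ℕ → ℕ) :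
    matchWord v ∈ MPalSharp ↔ v 0 = v 2 ∧ v 1 = v 3 := by
  rw [matchWord, sharpWord_mem_iff (by simp) (by simp) (by simp) (by simp)]
  constructor
  · rintro ⟨i, w, u, hw, hu, rfl⟩
    simp only [List.getElem?_append, List.length_replicate, List.getElem?_replicate,
      List.getElem?_singleton] at hw hu
    split_ifs at hw hu <;> simp only [Option.some.injEq] at hw hu <;> subst hw <;>
      simp [List.replicate_succ'] at hu
    · have := congrArg List.getLast? hu
      simp at this
    · have := congrArg List.length hu
      simp at this
      omega
  · rintro ⟨h0, h1⟩
    exact ⟨v 0, List.replicate (v 1 + 1) true, List.replicate (v 1 + 1) true, by simp,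
      by simp [h0, h1], by simp⟩

theorem avoidWord_notMem_iff (v : ℕ → ℕ) :
    avoidWord v ∉ MPalSharp ↔ v 0 = v 2 ∧ v 1 = v 3 := by
  rw [avoidWord, sharpWord_mem_iff (by simp) (by simp) (by simp) (by simp)]
  constructor
  · intro h
    by_contra hne
    apply h
    rcases lt_trichotomy (v 0) (v 2) with h02 | h02 | h02
    · exact ⟨v 0, [false], [false], by simp,
        by simp [List.getElem?_append, h02], rfl⟩
    · rcases lt_or_gt_of_ne (fun h13 => hne ⟨h02, h13⟩) with h13 | h13
      · refine ⟨v 0 + (v 1 + 1), [true], [true], ?_, ?_, rfl⟩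
        · simp
        · simp [List.getElem?_append, h02, h13]
      · refine ⟨v 0 + (v 3 + 1), [false], [false], ?_, ?_, rfl⟩
        · simp [List.getElem?_append, h13]
        · simp [h02]
    · exact ⟨v 2, [true], [true], by simp [List.getElem?_append, h02],
        by simp, rfl⟩
  · rintro ⟨h0, h1⟩ ⟨i, w, u, hw, hu, rfl⟩
    simp only [List.getElem?_append, List.length_replicate, List.getElem?_replicate,
      List.getElem?_singleton, h0, h1] at hw hu
    split_ifs at hw hu <;> simp only [Option.some.injEq] at hw hu <;> subst hw <;>
      simp at hu

theorem tape_matchWord (v : ℕ → ℕ) :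
    DPDA.tape (matchWord v) = blockWord
      (fun | 0 => [.lend] | 2 => [.ch none, .ch none] | 4 => [.rend] | _ => [.ch (some true)])
      (fun
        | 0 => [.ch (some false), .ch none]
        | 2 => [.ch (some false), .ch (some false), .ch none]
        | _ => [.ch (some true)]) v := by
  simp only [matchWord, sharpWord, blockWord, DPDA.tape]
  rw [sharpJoin_replicate_append _ _ (by simp), sharpJoin_replicate_append _ _ (by simp)]
  simp [map_rep, rep_singleton, List.replicate_succ, sharpJoin]

theorem tape_avoidWord (v : ℕ → ℕ) :
    DPDA.tape (avoidWord v) = blockWord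
      (fun
        | 0 => [.lend]
        | 1 => [.ch (some false), .ch none]
        | 2 => [.ch (some true), .ch none, .ch none]
        | 3 => [.ch (some true), .ch none]
        | _ => [.ch (some false), .rend])
      (fun
        | 0 => [.ch (some true), .ch none]
        | 1 => [.ch (some false), .ch none]
        | 2 => [.ch (some false), .ch none]
        | _ => [.ch (some true), .ch none]) v := by
  simp only [avoidWord, sharpWord, blockWord, DPDA.tape]
  repeat rw [sharpJoin_replicate_append _ _ (by simp)]
  simp [map_rep, rep_succ, sharpJoin]

end Words

namespace DPDA

variable {Q α Γ : Type} {M : DPDA Q α Γ}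

theorem stepN_eq_none_of_isHalting (hM : M.Valid) {c : Cfg Q α Γ} (hc : M.IsHalting c.st) {n : ℕ}
    (hn : n ≠ 0) : M.stepN n c = none := by
  obtain ⟨n, rfl⟩ := Nat.exists_eq_succ_of_ne_zero hn
  obtain ⟨q, i, s⟩ := c
  cases s with
  | nil => simp [stepN, step]
  | cons a s => cases i <;> simp [stepN, step, hM.2.1 q hc]

theorem not_accepts_of_rejects (hM : M.Valid) {x : List α} (hr : M.Rejects x) :
    ¬ M.Accepts x := by
  rintro ⟨m, a, ha, haA⟩
  obtain ⟨n, b, hb, hbR⟩ := hr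
  have key : ∀ {m n : ℕ} {a b : Cfg Q α Γ}, M.stepN m (M.init x) = some a → M.IsHalting a.st →
      M.stepN n (M.init x) = some b → n ≤ m := by
    intro m n a b ha hh hb
    by_contra hlt
    obtain ⟨k, rfl⟩ := Nat.exists_eq_add_of_le (not_le.1 hlt).le
    rw [stepN_add, ha, Option.bind_some, stepN_eq_none_of_isHalting hM hh (by omega)] at hb
    exact absurd hb (by simp)
  obtain rfl := le_antisymm (key hb (.inr hbR) ha) (key ha (.inl haA) hb)
  obtain rfl := Option.some.inj (ha.symm.trans hb)
  exact hM.1 _ haA hbR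

theorem compl_lang (hM : M.Valid) (hH : M.HaltsOnAll) :
    M.langᶜ = {x | M.Reaches M.Rej (M.init x)} := by
  ext x
  refine ⟨fun hx => ?_, fun hx => not_accepts_of_rejects hM hx⟩
  obtain ⟨n, c, hc, hA | hR⟩ := hH x
  · exact absurd ⟨n, c, hc, hA⟩ hx
  · exact ⟨n, c, hc, hR⟩

end DPDA

/-- `MPal#` belongs to neither `DCFL(ω)` nor `DCFL[ω]`. -/
theorem MPalSharp_not_in_DCFLInter_nor_DCFLUnion :
    ∀ d : ℕ, 1 ≤ d → ¬ DCFLInter d MPalSharp ∧ ¬ DCFLUnion d MPalSharp := by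
  refine fun d _ => ⟨?_, ?_⟩
  · rintro ⟨f, hf, hL⟩
    refine ne_iUnion_reaches (L := 3) (K := MPalSharpᶜ) (f := fun i => (f i)ᶜ) avoidWord
      ?_ ?_ tape_avoidWord
      (fun v hv => (avoidWord_notMem_iff v).1 hv)
      (fun n => (avoidWord_notMem_iff _).2 (by simp)) (fun i => ?_) (by rw [hL, Set.compl_iInter])
    · intro i; split <;> simp
    · intro i; split <;> simp
    · obtain ⟨Q, Γ, hQ, hΓ, M, hM, hH, hfi⟩ := hf i
      exact ⟨Q, Γ, hQ, hΓ, M, M.Rej, by rw [hfi, M.compl_lang hM hH]⟩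
  · rintro ⟨f, hf, hL⟩
    refine ne_iUnion_reaches (L := 3) (f := f) matchWord ?_ ?_ tape_matchWord
      (fun v hv => (matchWord_mem_iff v).1 hv)
      (fun n => (matchWord_mem_iff _).2 (by simp)) (fun i => ?_) hL
    · intro i; split <;> simp
    · intro i; split <;> simp
    · obtain ⟨Q, Γ, hQ, hΓ, M, -, -, hfi⟩ := hf i
      exact ⟨Q, Γ, hQ, hΓ, M, M.Acc, hfi⟩

end DCFLFormal
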